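/- arXiv:2201.12881 — 2 statements merged into one kernel-verified Lean document; each statement's English description precedes it below -/
import Mathlib

section
/- Let n ≥ 1, 0 ≤ θ < 1, x₀ ∈ ℝⁿ and 0 < r < 1, and set R := r^{1/(1−θ)}. Let b ∈ L¹(ℝⁿ) with supp b ⊆ B(x₀,r), let φ ∈ L¹(ℝⁿ) with φ ≥ 0, ∫φ = 1 and supp φ ⊆ B̄(0,R), and let K be locally integrable on ℝⁿ, integrable on {z : |z| ≥ 2r}, with [K]_{H∞,θ} < ∞. Then ∫_{|x−x₀| > 3r} |(b∗K)(x) − (b∗φ∗K)(x)| dx ≤ [K]_{H∞,θ} · ‖b‖_{L¹(ℝⁿ)}. -/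
open MeasureTheory Metric
open scoped ENNReal

/-- Convolution `(f ∗ g)(x) = ∫ f(y) g(x - y) dy` of complex-valued functions. -/
noncomputable def conv {n : ℕ} (f g : EuclideanSpace ℝ (Fin n) → ℂ) :
    EuclideanSpace ℝ (Fin n) → ℂ :=
  fun x => ∫ y, f y * g (x - y)

/-- Convolution `(φ ∗ K)(z) = ∫ φ(y) K(z - y) dy` of a real-valued function against a
complex-valued function. -/
noncomputable def convR {n : ℕ} (φ : EuclideanSpace ℝ (Fin n) → ℝ)
    (K : EuclideanSpace ℝ (Fin n) → ℂ) : EuclideanSpace ℝ (Fin n) → ℂ :=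
  fun z => ∫ y, φ y • K (z - y)

/-- The oscillating Hörmander constant
`[K]_{H∞,θ} = sup_{0<R<1} sup_{|y|<R} ∫_{|x| ≥ 2 R^{1-θ}} |K(x-y) - K(x)| dx`,
as an element of `[0,∞]`. -/
noncomputable def hormanderConst (n : ℕ) (θ : ℝ) (K : EuclideanSpace ℝ (Fin n) → ℂ) : ℝ≥0∞ :=
  ⨆ (R : ℝ) (_ : 0 < R) (_ : R < 1) (y : EuclideanSpace ℝ (Fin n)) (_ : ‖y‖ < R),
    ∫⁻ x in {x : EuclideanSpace ℝ (Fin n) | 2 * R ^ (1 - θ) ≤ ‖x‖},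
      (‖K (x - y) - K x‖₊ : ℝ≥0∞)

lemma hormander_swap_meas {n : ℕ} {F : EuclideanSpace ℝ (Fin n) → ℂ}
    (hF : AEStronglyMeasurable F volume) (S : Set (EuclideanSpace ℝ (Fin n))) :
    AEStronglyMeasurable (fun p : EuclideanSpace ℝ (Fin n) × EuclideanSpace ℝ (Fin n) =>
      F (p.1 - p.2)) ((volume.restrict S).prod volume) := by
  have h := hF.comp_quasiMeasurePreserving
    (quasiMeasurePreserving_sub (volume : Measure (EuclideanSpace ℝ (Fin n))) volume)
  refine h.mono_ac ?_
  exact Measure.AbsolutelyContinuous.prod Measure.restrict_le_self.absolutelyContinuous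
    Measure.AbsolutelyContinuous.rfl

/-- **Estimate for a single bad piece (Euclidean case): `∫_{G∖I*} |Tb_j - Tb̃_j| ≤ [K]_{H∞,θ} ‖b_j‖₁`.**
Here `b` is supported in `B(x₀,r)` with `0 < r < 1`, `R = r^{1/(1-θ)}`, `φ ≥ 0` is a mollifier
supported in `B̄(0,R)` with total mass `1`, and `K` is locally integrable, integrable on
`{|z| ≥ 2r}`, with finite oscillating Hörmander constant. -/
theorem single_bad_piece_estimate
    (n : ℕ) (hn : 1 ≤ n) (θ : ℝ) (hθ0 : 0 ≤ θ) (hθ1 : θ < 1)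
    (x₀ : EuclideanSpace ℝ (Fin n)) (r : ℝ) (hr0 : 0 < r) (hr1 : r < 1)
    (R : ℝ) (hR : R = r ^ (1 / (1 - θ)))
    (b : EuclideanSpace ℝ (Fin n) → ℂ) (hb_int : Integrable b volume)
    (hb_supp : Function.support b ⊆ ball x₀ r)
    (φ : EuclideanSpace ℝ (Fin n) → ℝ)
    (hφ_int : Integrable φ volume) (hφ_nonneg : ∀ x, 0 ≤ φ x)
    (hφ_one : ∫ x, φ x = 1)
    (hφ_supp : Function.support φ ⊆ closedBall (0 : EuclideanSpace ℝ (Fin n)) R)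
    (K : EuclideanSpace ℝ (Fin n) → ℂ) (hK : LocallyIntegrable K volume)
    (hK_int : IntegrableOn K {z : EuclideanSpace ℝ (Fin n) | 2 * r ≤ ‖z‖} volume)
    (hK_horm : hormanderConst n θ K < ⊤) :
    (∫⁻ x in {x : EuclideanSpace ℝ (Fin n) | 3 * r < ‖x - x₀‖},
        (‖conv b K x - conv b (convR φ K) x‖₊ : ℝ≥0∞)) ≤
      hormanderConst n θ K * eLpNorm b 1 volume := by
  have hθ : 0 < 1 - θ := by linarith
  have hR0 : 0 < R := by rw [hR]; positivity
  have hR1 : R < 1 := by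
    rw [hR]; exact Real.rpow_lt_one hr0.le hr1 (by positivity)
  have hRr : R ^ (1 - θ) = r := by
    rw [hR, ← Real.rpow_mul hr0.le, one_div, inv_mul_cancel₀ hθ.ne', Real.rpow_one]
  set T : Set (EuclideanSpace ℝ (Fin n)) := {z | 2 * r ≤ ‖z‖} with hT
  set S : Set (EuclideanSpace ℝ (Fin n)) := {x | 3 * r < ‖x - x₀‖} with hS
  have hTm : MeasurableSet T := (isClosed_le continuous_const continuous_norm).measurableSet
  have hSm : MeasurableSet S :=
    (isOpen_lt continuous_const (continuous_id.sub continuous_const).norm).measurableSet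
  -- `K` is globally integrable
  have hKI : Integrable K volume := by
    have h1 : IntegrableOn K (closedBall 0 (2 * r)) volume :=
      hK.integrableOn_isCompact (isCompact_closedBall _ _)
    have h2 := h1.union hK_int
    rw [← integrableOn_univ]
    refine h2.mono_set ?_
    intro z _
    rcases le_total ‖z‖ (2 * r) with h | h
    · left; simpa using h
    · right; exact h
  have hconvI : Integrable (convR φ K) volume :=
    hφ_int.integrable_convolution (ContinuousLinearMap.lsmul ℝ ℝ) hKI
  have hconvE : ∀ᵐ z, Integrable (fun y => φ y • K (z - y)) volume :=
    hφ_int.ae_convolution_exists (ContinuousLinearMap.lsmul ℝ ℝ) hKI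
  have hbK : ∀ᵐ x, Integrable (fun y => b y * K (x - y)) volume :=
    hb_int.ae_convolution_exists (ContinuousLinearMap.mul ℝ ℂ) hKI
  have hbC : ∀ᵐ x, Integrable (fun y => b y * convR φ K (x - y)) volume :=
    hb_int.ae_convolution_exists (ContinuousLinearMap.mul ℝ ℂ) hconvI
  set G : EuclideanSpace ℝ (Fin n) → ℂ := fun z => K z - convR φ K z with hG
  have hGI : Integrable G volume := hKI.sub hconvI
  -- bound for `G`
  have hφ_l : ∫⁻ w, ‖φ w‖ₑ = 1 := by
    have h := ofReal_integral_eq_lintegral_ofReal hφ_int (Filter.Eventually.of_forall hφ_nonneg)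
    rw [hφ_one, ENNReal.ofReal_one] at h
    rw [h]
    exact lintegral_congr fun w => Real.enorm_of_nonneg (hφ_nonneg w)
  have hball : ∀ᵐ w : EuclideanSpace ℝ (Fin n), φ w ≠ 0 → ‖w‖ < R := by
    have h0 : volume (sphere (0 : EuclideanSpace ℝ (Fin n)) R) = 0 :=
      Measure.addHaar_sphere_of_ne_zero _ _ hR0.ne'
    have : ∀ᵐ w : EuclideanSpace ℝ (Fin n), w ∉ sphere (0 : EuclideanSpace ℝ (Fin n)) R :=
      measure_eq_zero_iff_ae_notMem.1 h0
    filter_upwards [this] with w hw hne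
    have h1 : w ∈ closedBall (0 : EuclideanSpace ℝ (Fin n)) R := hφ_supp hne
    simp only [mem_closedBall, mem_sphere, dist_zero_right] at h1 hw
    exact lt_of_le_of_ne h1 hw
  have hGbound : ∫⁻ z in T, ‖G z‖ₑ ≤ hormanderConst n θ K := by
    calc ∫⁻ z in T, ‖G z‖ₑ
        ≤ ∫⁻ z in T, ∫⁻ w, ‖φ w‖ₑ * ‖K (z - w) - K z‖ₑ := by
          refine lintegral_mono_ae (ae_restrict_of_ae ?_)
          filter_upwards [hconvE] with z hz
          have e : G z = ∫ w, (φ w • K z - φ w • K (z - w)) := by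
            rw [integral_sub (hφ_int.smul_const _) hz, integral_smul_const, hφ_one, one_smul]
            rfl
          rw [e]
          refine (enorm_integral_le_lintegral_enorm _).trans (lintegral_mono fun w => ?_)
          rw [← smul_sub, enorm_smul, ← enorm_neg (K z - _), neg_sub]
      _ = ∫⁻ w, ∫⁻ z in T, ‖φ w‖ₑ * ‖K (z - w) - K z‖ₑ := by
          refine lintegral_lintegral_swap ?_
          have hA := hormander_swap_meas hKI.aestronglyMeasurable T
          have hB : AEStronglyMeasurable
              (fun p : EuclideanSpace ℝ (Fin n) × EuclideanSpace ℝ (Fin n) => K p.1)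
              ((volume.restrict T).prod volume) :=
            hKI.aestronglyMeasurable.restrict.comp_fst
          have hC : AEStronglyMeasurable
              (fun p : EuclideanSpace ℝ (Fin n) × EuclideanSpace ℝ (Fin n) => φ p.2)
              ((volume.restrict T).prod volume) :=
            hφ_int.aestronglyMeasurable.comp_snd
          exact hC.enorm.mul (hA.sub hB).enorm
      _ ≤ ∫⁻ w, ‖φ w‖ₑ * hormanderConst n θ K := by
          refine lintegral_mono_ae ?_
          filter_upwards [hball] with w hw
          rw [lintegral_const_mul' _ _ enorm_ne_top]
          by_cases h0 : φ w = 0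
          · simp [h0]
          gcongr
          have hle : ∫⁻ x in {x : EuclideanSpace ℝ (Fin n) | 2 * R ^ (1 - θ) ≤ ‖x‖},
              (‖K (x - w) - K x‖₊ : ℝ≥0∞) ≤ hormanderConst n θ K := by
            unfold hormanderConst
            exact le_iSup_of_le R (le_iSup_of_le hR0 (le_iSup_of_le hR1
              (le_iSup_of_le w (le_iSup_of_le (hw h0) le_rfl))))
          rw [hRr] at hle
          exact hle
      _ = hormanderConst n θ K := by
          rw [lintegral_mul_const' _ _ hK_horm.ne, hφ_l, one_mul]
  calc ∫⁻ x in S, (‖conv b K x - conv b (convR φ K) x‖₊ : ℝ≥0∞)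
      ≤ ∫⁻ x in S, ∫⁻ y, ‖b y‖ₑ * ‖G (x - y)‖ₑ := by
        refine lintegral_mono_ae (ae_restrict_of_ae ?_)
        filter_upwards [hbK, hbC] with x h1 h2
        have e : conv b K x - conv b (convR φ K) x = ∫ y, b y * G (x - y) := by
          unfold conv
          rw [← integral_sub h1 h2]
          refine integral_congr_ae (Filter.Eventually.of_forall fun y => ?_)
          simp only [hG, mul_sub]
        rw [e]
        refine (enorm_integral_le_lintegral_enorm _).trans (lintegral_mono fun y => ?_)
        rw [enorm_mul]
    _ = ∫⁻ y, ∫⁻ x in S, ‖b y‖ₑ * ‖G (x - y)‖ₑ := by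
        refine lintegral_lintegral_swap ?_
        have hA := hormander_swap_meas hGI.aestronglyMeasurable S
        have hC : AEStronglyMeasurable
            (fun p : EuclideanSpace ℝ (Fin n) × EuclideanSpace ℝ (Fin n) => b p.2)
            ((volume.restrict S).prod volume) :=
          hb_int.aestronglyMeasurable.comp_snd
        exact hC.enorm.mul hA.enorm
    _ ≤ ∫⁻ y, ‖b y‖ₑ * hormanderConst n θ K := by
        refine lintegral_mono fun y => ?_
        dsimp only
        rw [lintegral_const_mul' _ _ enorm_ne_top]
        by_cases h0 : b y = 0
        · simp [h0]
        gcongr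
        refine le_trans ?_ hGbound
        rw [← lintegral_indicator hSm, ← lintegral_indicator hTm,
          ← lintegral_sub_right_eq_self (T.indicator fun z => ‖G z‖ₑ) y]
        refine lintegral_mono fun x => ?_
        by_cases hx : x ∈ S
        · have hy : ‖y - x₀‖ < r := by
            have := hb_supp (show y ∈ Function.support b from h0)
            rwa [mem_ball, dist_eq_norm] at this
          have hxy : x - y ∈ T := by
            have h3 : 3 * r < ‖x - x₀‖ := hx
            have h4 : ‖x - x₀‖ ≤ ‖x - y‖ + ‖y - x₀‖ := norm_sub_le_norm_sub_add_norm_sub _ _ _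
            change 2 * r ≤ ‖x - y‖
            linarith
          simp [hx, hxy]
        · simp [hx]
    _ = hormanderConst n θ K * eLpNorm b 1 volume := by
        rw [lintegral_mul_const' _ _ hK_horm.ne, eLpNorm_one_eq_lintegral_enorm, mul_comm]
end

section
/- Let n ≥ 1 and 0 ≤ θ < 1. Let (I_j)_{j∈ℕ} be a countable family of open balls I_j = B(x_j,r_j) with 0 < r_j < 1, let b_j ∈ L¹(ℝⁿ) with supp b_j ⊆ I_j and Σ_j ‖b_j‖_{L¹} < ∞. Let φ ∈ L¹(ℝⁿ) with φ ≥ 0, ∫φ = 1, supp φ ⊆ B̄(0,1), set R_j := r_j^{1/(1−θ)} and φ_j(x) := R_j^{−n}φ(R_j^{−1}x). Let K be locally integrable on ℝⁿ, integrable on {z : |z| ≥ r} for every r > 0, with [K]_{H∞,θ} < ∞. Set I* := ⋃_j B(x_j, 3r_j). Then ∫_{ℝⁿ∖I*} | Σ_j ((b_j∗K)(x) − (b_j∗φ_j∗K)(x)) | dx ≤ [K]_{H∞,θ} · Σ_j ‖b_j‖_{L¹(ℝⁿ)}. -/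
open MeasureTheory Metric
open scoped ENNReal

/-- A mollification error, integrated over the region away from the origin. -/
lemma mollify_error_bound {n : ℕ} (θ : ℝ) (r R : ℝ) (hr0 : 0 < r)
    (hR0 : 0 < R) (hR1 : R < 1) (hRr : R ≤ r) (hRθ : R ^ (1 - θ) = r)
    (φ : EuclideanSpace ℝ (Fin n) → ℝ)
    (hφ_int : Integrable φ volume) (hφ_nonneg : ∀ w, 0 ≤ φ w)
    (hφ_one : ∫ w, φ w = 1)
    (hφ_supp : ∀ w, φ w ≠ 0 → ‖w‖ ≤ R)
    (K K' : EuclideanSpace ℝ (Fin n) → ℂ) (hK' : Integrable K' volume)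
    (hKK' : ∀ u, r ≤ ‖u‖ → K' u = K u) :
    ∫⁻ u in {u : EuclideanSpace ℝ (Fin n) | 2 * r ≤ ‖u‖}, ‖K' u - convR φ K' u‖ₑ
      ≤ hormanderConst n θ K := by
  have hex : ∀ᵐ u : EuclideanSpace ℝ (Fin n), Integrable (fun w => φ w • K' (u - w)) :=
    hφ_int.ae_convolution_exists (ContinuousLinearMap.lsmul ℝ ℝ) hK'
  have hφE : ∫⁻ w, ‖φ w‖ₑ = 1 := by
    have h := ofReal_integral_eq_lintegral_ofReal hφ_int (Filter.Eventually.of_forall hφ_nonneg)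
    rw [hφ_one, ENNReal.ofReal_one] at h
    rw [h]
    exact lintegral_congr fun w => Real.enorm_eq_ofReal (hφ_nonneg w)
  have hmA : MeasurableSet {u : EuclideanSpace ℝ (Fin n) | 2 * r ≤ ‖u‖} :=
    measurableSet_le measurable_const measurable_norm
  have hmeas : AEMeasurable (fun p : EuclideanSpace ℝ (Fin n) × EuclideanSpace ℝ (Fin n) =>
      ‖φ p.2‖ₑ * ‖K' p.1 - K' (p.1 - p.2)‖ₑ) (volume.prod volume) := by
    have h1 := hK'.aestronglyMeasurable.comp_quasiMeasurePreserving
      (quasiMeasurePreserving_sub_of_right_invariant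
        (volume : Measure (EuclideanSpace ℝ (Fin n))) volume)
    have h2 : AEStronglyMeasurable
      (fun p : EuclideanSpace ℝ (Fin n) × EuclideanSpace ℝ (Fin n) => K' p.1)
      (volume.prod volume) := hK'.aestronglyMeasurable.comp_fst
    have h3 : AEStronglyMeasurable
      (fun p : EuclideanSpace ℝ (Fin n) × EuclideanSpace ℝ (Fin n) => φ p.2)
      (volume.prod volume) := hφ_int.aestronglyMeasurable.comp_snd
    exact h3.enorm.mul (h2.sub h1).enorm
  have hsphere : ∀ᵐ w : EuclideanSpace ℝ (Fin n), ‖w‖ ≠ R := by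
    have h := Measure.addHaar_sphere_of_ne_zero
      (volume : Measure (EuclideanSpace ℝ (Fin n))) 0 hR0.ne'
    filter_upwards [measure_eq_zero_iff_ae_notMem.1 h] with w hw
    simpa using hw
  calc ∫⁻ u in {u : EuclideanSpace ℝ (Fin n) | 2 * r ≤ ‖u‖}, ‖K' u - convR φ K' u‖ₑ
      ≤ ∫⁻ u in {u : EuclideanSpace ℝ (Fin n) | 2 * r ≤ ‖u‖},
          ∫⁻ w, ‖φ w‖ₑ * ‖K' u - K' (u - w)‖ₑ := by
        refine lintegral_mono_ae (ae_restrict_of_ae ?_)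
        filter_upwards [hex] with u hu
        have : K' u - convR φ K' u = ∫ w, φ w • (K' u - K' (u - w)) := by
          simp_rw [smul_sub]
          rw [integral_sub (hφ_int.smul_const _) hu, integral_smul_const, hφ_one, one_smul]
          rfl
        rw [this]
        refine (enorm_integral_le_lintegral_enorm _).trans (le_of_eq ?_)
        exact lintegral_congr fun w => enorm_smul _ _
    _ = ∫⁻ w, ∫⁻ u in {u : EuclideanSpace ℝ (Fin n) | 2 * r ≤ ‖u‖},
          ‖φ w‖ₑ * ‖K' u - K' (u - w)‖ₑ := by
        refine lintegral_lintegral_swap (hmeas.mono_ac ?_)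
        exact Measure.restrict_le_self.absolutelyContinuous.prod Measure.AbsolutelyContinuous.rfl
    _ ≤ ∫⁻ w, ‖φ w‖ₑ * hormanderConst n θ K := by
        refine lintegral_mono_ae ?_
        filter_upwards [hsphere] with w hw
        by_cases h0 : φ w = 0
        · simp [h0]
        have hwR : ‖w‖ < R := lt_of_le_of_ne (hφ_supp w h0) hw
        rw [lintegral_const_mul' _ _ enorm_ne_top]
        gcongr
        have : ∫⁻ u in {u : EuclideanSpace ℝ (Fin n) | 2 * r ≤ ‖u‖}, ‖K' u - K' (u - w)‖ₑ
            = ∫⁻ u in {u : EuclideanSpace ℝ (Fin n) | 2 * R ^ (1 - θ) ≤ ‖u‖},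
              (‖K (u - w) - K u‖₊ : ℝ≥0∞) := by
          rw [hRθ]
          refine setLIntegral_congr_fun hmA fun u hu => ?_
          have hu' : 2 * r ≤ ‖u‖ := hu
          have h1 := norm_sub_norm_le u w
          rw [hKK' u (by linarith), hKK' (u - w) (by linarith), ← enorm_eq_nnnorm, enorm_sub_rev]
        rw [this]
        unfold hormanderConst
        exact le_iSup_of_le R (le_iSup_of_le hR0 (le_iSup_of_le hR1
          (le_iSup_of_le w (le_iSup_of_le hwR le_rfl))))
    _ = hormanderConst n θ K := by
        rw [lintegral_mul_const'' _ hφ_int.aestronglyMeasurable.enorm, hφE, one_mul]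

/-- The estimate for a single ball, with a measurable majorant. -/
lemma single_ball_bound {n : ℕ} (θ : ℝ) (r R : ℝ) (hr0 : 0 < r)
    (hR0 : 0 < R) (hR1 : R < 1) (hRr : R ≤ r) (hRθ : R ^ (1 - θ) = r)
    (φ : EuclideanSpace ℝ (Fin n) → ℝ)
    (hφ_int : Integrable φ volume) (hφ_nonneg : ∀ w, 0 ≤ φ w)
    (hφ_one : ∫ w, φ w = 1)
    (hφ_supp : ∀ w, φ w ≠ 0 → ‖w‖ ≤ R)
    (K : EuclideanSpace ℝ (Fin n) → ℂ)
    (hK_int : IntegrableOn K {z : EuclideanSpace ℝ (Fin n) | r ≤ ‖z‖} volume)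
    (x : EuclideanSpace ℝ (Fin n)) (b : EuclideanSpace ℝ (Fin n) → ℂ)
    (hb_int : Integrable b volume)
    (hb_supp : Function.support b ⊆ ball x r) :
    ∃ ψ : EuclideanSpace ℝ (Fin n) → ℝ≥0∞, AEMeasurable ψ volume ∧
      (∀ᵐ z, z ∉ ball x (3 * r) → ‖conv b K z - conv b (convR φ K) z‖ₑ ≤ ψ z) ∧
      ∫⁻ z in (ball x (3 * r))ᶜ, ψ z ≤ hormanderConst n θ K * eLpNorm b 1 volume := by
  have hmS : MeasurableSet {z : EuclideanSpace ℝ (Fin n) | r ≤ ‖z‖} :=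
    measurableSet_le measurable_const measurable_norm
  have hmA : MeasurableSet {z : EuclideanSpace ℝ (Fin n) | 2 * r ≤ ‖z‖} :=
    measurableSet_le measurable_const measurable_norm
  obtain ⟨K', hK'def⟩ : ∃ K', K' = Set.indicator {z : EuclideanSpace ℝ (Fin n) | r ≤ ‖z‖} K :=
    ⟨_, rfl⟩
  have hK' : Integrable K' volume := by rw [hK'def]; exact hK_int.integrable_indicator hmS
  have hKK' : ∀ u, r ≤ ‖u‖ → K' u = K u := fun u hu => by
    rw [hK'def]; exact Set.indicator_of_mem (s := {z | r ≤ ‖z‖}) hu K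
  have hG := mollify_error_bound θ r R hr0 hR0 hR1 hRr hRθ φ hφ_int hφ_nonneg hφ_one hφ_supp
    K K' hK' hKK'
  have hconv : Integrable (convR φ K') volume :=
    hφ_int.integrable_convolution (ContinuousLinearMap.lsmul ℝ ℝ) hK'
  have hmeas : AEMeasurable (fun p : EuclideanSpace ℝ (Fin n) × EuclideanSpace ℝ (Fin n) =>
      ‖b p.2‖ₑ * ‖K' (p.1 - p.2) - convR φ K' (p.1 - p.2)‖ₑ) (volume.prod volume) := by
    have h1 := (hK'.sub hconv).aestronglyMeasurable.comp_quasiMeasurePreserving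
      (quasiMeasurePreserving_sub_of_right_invariant
        (volume : Measure (EuclideanSpace ℝ (Fin n))) volume)
    have h3 : AEStronglyMeasurable
      (fun p : EuclideanSpace ℝ (Fin n) × EuclideanSpace ℝ (Fin n) => b p.2)
      (volume.prod volume) := hb_int.aestronglyMeasurable.comp_snd
    exact h3.enorm.mul h1.enorm
  refine ⟨fun z => ∫⁻ y, ‖b y‖ₑ * ‖K' (z - y) - convR φ K' (z - y)‖ₑ,
    hmeas.lintegral_prod_right', ?_, ?_⟩
  · have e1 : ∀ᵐ z : EuclideanSpace ℝ (Fin n), Integrable (fun y => b y * K' (z - y)) :=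
      hb_int.ae_convolution_exists (ContinuousLinearMap.mul ℝ ℂ) hK'
    have e2 : ∀ᵐ z : EuclideanSpace ℝ (Fin n), Integrable (fun y => b y * convR φ K' (z - y)) :=
      hb_int.ae_convolution_exists (ContinuousLinearMap.mul ℝ ℂ) hconv
    filter_upwards [e1, e2] with z h1 h2 hz
    have hfar : ∀ y, b y ≠ 0 → 2 * r ≤ ‖z - y‖ := fun y hy => by
      have hy' := hb_supp hy
      rw [mem_ball] at hy' hz
      have := dist_triangle z y x
      rw [← dist_eq_norm]
      linarith
    have c1 : conv b K z = ∫ y, b y * K' (z - y) := by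
      refine integral_congr_ae (Filter.Eventually.of_forall fun y => ?_)
      by_cases hy : b y = 0
      · simp [hy]
      · simp only
        rw [hKK' _ (by linarith [hfar y hy])]
    have c2 : conv b (convR φ K) z = ∫ y, b y * convR φ K' (z - y) := by
      refine integral_congr_ae (Filter.Eventually.of_forall fun y => ?_)
      by_cases hy : b y = 0
      · simp [hy]
      · simp only
        congr 1
        refine integral_congr_ae (Filter.Eventually.of_forall fun w => ?_)
        by_cases hw : φ w = 0
        · simp [hw]
        · simp only
          have := hφ_supp w hw
          have := hfar y hy
          have := norm_sub_norm_le (z - y) w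
          rw [hKK' _ (by linarith)]
    rw [c1, c2, ← integral_sub h1 h2]
    refine (enorm_integral_le_lintegral_enorm _).trans (le_of_eq ?_)
    exact lintegral_congr fun y => by rw [← mul_sub, enorm_mul]
  · calc ∫⁻ z in (ball x (3 * r))ᶜ, ∫⁻ y, ‖b y‖ₑ * ‖K' (z - y) - convR φ K' (z - y)‖ₑ
        = ∫⁻ y, ∫⁻ z in (ball x (3 * r))ᶜ, ‖b y‖ₑ * ‖K' (z - y) - convR φ K' (z - y)‖ₑ := by
          refine lintegral_lintegral_swap (hmeas.mono_ac ?_)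
          exact Measure.restrict_le_self.absolutelyContinuous.prod Measure.AbsolutelyContinuous.rfl
      _ ≤ ∫⁻ y, ‖b y‖ₑ * hormanderConst n θ K := by
          refine lintegral_mono fun y => ?_
          by_cases hy : b y = 0
          · simp [hy]
          rw [lintegral_const_mul' _ _ enorm_ne_top]
          gcongr
          refine le_trans ?_ hG
          rw [← lintegral_indicator measurableSet_ball.compl, ← lintegral_indicator hmA,
            ← lintegral_sub_right_eq_self (Set.indicator {u | 2 * r ≤ ‖u‖} _) y]
          refine lintegral_mono fun z => ?_
          by_cases hz : z ∈ (ball x (3 * r))ᶜ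
          · rw [Set.indicator_of_mem hz]
            have hy' := hb_supp hy
            simp only [Set.mem_compl_iff, mem_ball, not_lt] at hy' hz
            have := dist_triangle z y x
            rw [Set.indicator_of_mem]
            rw [Set.mem_setOf_eq, ← dist_eq_norm]
            linarith
          · rw [Set.indicator_of_notMem hz]
            exact zero_le
      _ = hormanderConst n θ K * eLpNorm b 1 volume := by
          rw [lintegral_mul_const'' _ hb_int.aestronglyMeasurable.enorm,
            eLpNorm_one_eq_lintegral_enorm, mul_comm]

/-- **The mollified bad part is a good replacement away from the dilated balls
(Euclidean case of `‖T(b - b̃)‖_{L¹(G∖I*)} ≤ [K]_{H∞,θ} ‖f‖₁`):**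
with `b̃_j = b_j ∗ φ_j`, where `φ_j` is the mollifier of profile `φ` at scale
`R_j = r_j^{1/(1-θ)}`, and `I* = ⋃_j B(x_j, 3 r_j)`, one has
`∫_{ℝⁿ∖I*} |Σ_j (b_j∗K − b_j∗φ_j∗K)| ≤ [K]_{H∞,θ} Σ_j ‖b_j‖₁`. -/
theorem mollified_bad_part_estimate
    (n : ℕ) (hn : 1 ≤ n) (θ : ℝ) (hθ0 : 0 ≤ θ) (hθ1 : θ < 1)
    (x : ℕ → EuclideanSpace ℝ (Fin n)) (r : ℕ → ℝ)
    (hr0 : ∀ j, 0 < r j) (hr1 : ∀ j, r j < 1)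
    (b : ℕ → EuclideanSpace ℝ (Fin n) → ℂ)
    (hb_int : ∀ j, Integrable (b j) volume)
    (hb_supp : ∀ j, Function.support (b j) ⊆ ball (x j) (r j))
    (hb_sum : (∑' j : ℕ, eLpNorm (b j) 1 volume) < ⊤)
    (φ : EuclideanSpace ℝ (Fin n) → ℝ)
    (hφ_int : Integrable φ volume) (hφ_nonneg : ∀ w, 0 ≤ φ w)
    (hφ_one : ∫ w, φ w = 1)
    (hφ_supp : Function.support φ ⊆ closedBall (0 : EuclideanSpace ℝ (Fin n)) 1)
    (K : EuclideanSpace ℝ (Fin n) → ℂ) (hK : LocallyIntegrable K volume)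
    (hK_int : ∀ ρ : ℝ, 0 < ρ →
      IntegrableOn K {z : EuclideanSpace ℝ (Fin n) | ρ ≤ ‖z‖} volume)
    (hK_horm : hormanderConst n θ K < ⊤) :
    (∫⁻ z in (⋃ j : ℕ, ball (x j) (3 * r j))ᶜ,
        (‖∑' j : ℕ, (conv (b j) K z -
          conv (b j) (convR
            (fun w => (r j ^ (1 / (1 - θ))) ^ (-(n : ℝ)) *
              φ ((r j ^ (1 / (1 - θ)))⁻¹ • w)) K) z)‖₊ : ℝ≥0∞)) ≤
      hormanderConst n θ K * ∑' j : ℕ, eLpNorm (b j) 1 volume := by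
  have hθ : 0 < 1 - θ := by linarith
  have key := fun j => by
    have hR0 : 0 < r j ^ (1 / (1 - θ)) := Real.rpow_pos_of_pos (hr0 j) _
    refine single_ball_bound (n := n) θ (r j) (r j ^ (1 / (1 - θ))) (hr0 j) hR0
      (Real.rpow_lt_one (hr0 j).le (hr1 j) (by positivity)) ?_ ?_
      (fun w => (r j ^ (1 / (1 - θ))) ^ (-(n : ℝ)) * φ ((r j ^ (1 / (1 - θ)))⁻¹ • w))
      ((hφ_int.comp_smul (inv_ne_zero hR0.ne')).const_mul _)
      (fun w => mul_nonneg (by positivity) (hφ_nonneg _)) ?_ ?_ K (hK_int _ (hr0 j))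
      (x j) (b j) (hb_int j) (hb_supp j)
    · conv_rhs => rw [← Real.rpow_one (r j)]
      refine Real.rpow_le_rpow_of_exponent_ge (hr0 j) (hr1 j).le ?_
      rw [le_div_iff₀ hθ]; linarith
    · rw [← Real.rpow_mul (hr0 j).le, one_div, inv_mul_cancel₀ hθ.ne', Real.rpow_one]
    · rw [integral_const_mul, Measure.integral_comp_inv_smul_of_nonneg _ _ hR0.le, hφ_one,
        finrank_euclideanSpace_fin, Real.rpow_neg hR0.le, Real.rpow_natCast, smul_eq_mul, mul_one,
        inv_mul_cancel₀ (pow_pos hR0 n).ne']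
    · intro w hw
      have h := hφ_supp (right_ne_zero_of_mul hw)
      rw [mem_closedBall_zero_iff, norm_smul, norm_inv, Real.norm_of_nonneg hR0.le,
        inv_mul_le_iff₀ hR0, mul_one] at h
      exact h
  choose ψ hψm hψ hψi using key
  calc _ ≤ ∫⁻ z in (⋃ j : ℕ, ball (x j) (3 * r j))ᶜ, ∑' j, ψ j z := by
        refine lintegral_mono_ae ?_
        have hm : MeasurableSet (⋃ j : ℕ, ball (x j) (3 * r j))ᶜ :=
          (MeasurableSet.iUnion fun j => measurableSet_ball).compl
        filter_upwards [ae_restrict_of_ae (ae_all_iff.2 hψ), ae_restrict_mem hm] with z hz hzm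
        rw [← enorm_eq_nnnorm]
        refine enorm_tsum_le_tsum_enorm.trans (ENNReal.tsum_le_tsum fun j => hz j ?_)
        exact fun h => hzm (Set.mem_iUnion_of_mem j h)
    _ = ∑' j, ∫⁻ z in (⋃ j : ℕ, ball (x j) (3 * r j))ᶜ, ψ j z :=
        lintegral_tsum fun j => (hψm j).restrict
    _ ≤ ∑' j, hormanderConst n θ K * eLpNorm (b j) 1 volume := by
        refine ENNReal.tsum_le_tsum fun j => le_trans (lintegral_mono_set ?_) (hψi j)
        exact Set.compl_subset_compl.2 (Set.subset_iUnion (fun j => ball (x j) (3 * r j)) j)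
    _ = _ := ENNReal.tsum_mul_left
end
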